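/- Let F ⊆ ℂ be a closed Arakelian set. Then for every function f : ℂ → ℂ that is continuous on F, holomorphic on the interior of F, and has no zeros on F, there exists a function g : ℂ → ℂ, continuous on F and holomorphic on the interior of F, such that exp(g(z)) = f(z) for all z ∈ F. -/

import Mathlib

open Complex Metric Bornology

/-- A closed set `F ⊆ ℂ` is Arakelian if every connected component of its complement
is unbounded, and for every compact `K`, the union of all bounded connected components
of `ℂ \ (F ∪ K)` is bounded. -/
def IsArakelian (F : Set ℂ) : Prop :=
  (∀ z ∈ Fᶜ, ¬ IsBounded (connectedComponentIn Fᶜ z)) ∧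
  (∀ K : Set ℂ, IsCompact K →
    IsBounded {z : ℂ | z ∈ (F ∪ K)ᶜ ∧ IsBounded (connectedComponentIn (F ∪ K)ᶜ z)})


def HasLogOn (K : Set ℂ) (f : ℂ → ℂ) : Prop :=
  ∃ g : ℂ → ℂ, ContinuousOn g K ∧ ∀ z ∈ K, Complex.exp (g z) = f z

lemma HasLogOn.mono {K L : Set ℂ} {f : ℂ → ℂ} (h : HasLogOn K f) (hL : L ⊆ K) :
    HasLogOn L f := by
  obtain ⟨g, hg, hg'⟩ := h
  exact ⟨g, hg.mono hL, fun z hz => hg' z (hL hz)⟩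

lemma HasLogOn.mul {K : Set ℂ} {f g h : ℂ → ℂ} (hf : HasLogOn K f) (hg : HasLogOn K g)
    (hh : ∀ z ∈ K, h z = f z * g z) : HasLogOn K h := by
  obtain ⟨u, hu, hu'⟩ := hf
  obtain ⟨v, hv, hv'⟩ := hg
  exact ⟨fun z => u z + v z, hu.add hv, fun z hz => by
    rw [Complex.exp_add, hu' z hz, hv' z hz, hh z hz]⟩

lemma hasLogOn_const (K : Set ℂ) {c : ℂ} (hc : c ≠ 0) : HasLogOn K (fun _ => c) :=
  ⟨fun _ => Complex.log c, continuousOn_const, fun _ _ => Complex.exp_log hc⟩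

lemma hasLogOn_slit {K : Set ℂ} {f : ℂ → ℂ} (hf : ContinuousOn f K)
    (h : ∀ z ∈ K, f z ∈ slitPlane) : HasLogOn K f :=
  ⟨fun z => Complex.log (f z), hf.clog h, fun z hz => Complex.exp_log (slitPlane_ne_zero (h z hz))⟩

lemma HasLogOn.comp {K : Set ℂ} {f : ℂ → ℂ} (h : HasLogOn K f) {φ : ℂ → ℂ} (hφ : Continuous φ) :
    HasLogOn (φ ⁻¹' K) (fun z => f (φ z)) := by
  obtain ⟨g, hg, hg'⟩ := h
  exact ⟨fun z => g (φ z), hg.comp hφ.continuousOn (fun z hz => hz), fun z hz => hg' _ hz⟩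

/-- every translate `z - a` with `a ∉ K` has a continuous logarithm on `K`. -/
def GoodSet (K : Set ℂ) : Prop := IsCompact K ∧ ∀ a, a ∉ K → HasLogOn K (fun z => z - a)

/-- A nonvanishing continuous function that stays close to one of its values has a log. -/
lemma hasLogOn_of_near {K : Set ℂ} {f : ℂ → ℂ} (hf : ContinuousOn f K) {c : ℂ}
    (h : ∀ z ∈ K, ‖f z - c‖ < ‖c‖) : HasLogOn K f := by
  by_cases hc : c = 0
  · subst hc
    refine ⟨f, hf, fun z hz => ?_⟩
    have := h z hz
    simp at this
    exact absurd this (not_lt.mpr (norm_nonneg _))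
  · refine (hasLogOn_const K hc).mul (g := fun z => 1 + (f z - c) / c)
      (hasLogOn_slit (by fun_prop) fun z hz => ?_) (fun z hz => by field_simp; ring)
    apply mem_slitPlane_of_norm_lt_one
    rw [norm_div, div_lt_one (norm_pos_iff.mpr hc)]
    exact h z hz

lemma logR_jump {w : ℂ} (hw : w.re = 0) (h0 : 0 < w.im) :
    Complex.log (-w) + Real.pi * I - Complex.log w = 0 := by
  obtain ⟨x, y⟩ := w
  simp only at hw h0
  subst hw
  apply Complex.ext
  · simp [Complex.log_re, Complex.norm_def, normSq]
  · have e : (⟨0, y⟩ : ℂ) = (y : ℂ) * I := by apply Complex.ext <;> simp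
    have e2 : -((y : ℂ) * I) = (y : ℂ) * (-I) := by ring
    simp [Complex.log_im]
    rw [e, e2, arg_real_mul _ h0, arg_real_mul _ h0]
    simp
    ring

lemma logR_jump' {w : ℂ} (hw : w.re = 0) (h0 : w.im < 0) :
    Complex.log (-w) + Real.pi * I - Complex.log w = 2 * Real.pi * I := by
  have := logR_jump (w := -w) (by simp [hw]) (by simp [h0])
  simp only [neg_neg] at this
  linear_combination -this

lemma exp_eq_exp_diff {a b : ℂ} (h : Complex.exp a = Complex.exp b) :
    ∃ n : ℤ, a - b = n * (2 * Real.pi * I) := by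
  obtain ⟨n, hn⟩ := Complex.exp_eq_exp_iff_exists_int.mp h
  exact ⟨n, by rw [hn]; ring⟩

/-- pairs of logs -/
def PairProp (K : Set ℂ) (f : ℂ → ℂ) (c : ℝ) (n0 : ℂ → ℂ) (t : ℝ) : Prop :=
  ∃ h1 h2 : ℂ → ℂ, ∃ j : ℤ, ContinuousOn h1 (K ∩ {z | z.re ≤ c}) ∧
    ContinuousOn h2 (K ∩ {z | c ≤ z.re}) ∧
    (∀ z ∈ K ∩ {z | z.re ≤ c}, Complex.exp (h1 z) = f z) ∧
    (∀ z ∈ K ∩ {z | c ≤ z.re}, Complex.exp (h2 z) = f z) ∧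
    (∀ z ∈ K, z.re = c → z.im ≤ t → h1 z - h2 z = 0) ∧
    (∀ z ∈ K, z.re = c → t ≤ z.im → h1 z - h2 z = n0 z + j * (2 * Real.pi * I))

/-- adjusting the jump at a point off `K` -/
lemma PairProp.adjust {K : Set ℂ} {f : ℂ → ℂ} {c : ℝ} {n0 : ℂ → ℂ} {t : ℝ}
    (hK : GoodSet K) (ht : (⟨c, t⟩ : ℂ) ∉ K) (m : ℤ) {h1 h2 : ℂ → ℂ} {j : ℤ}
    (hh : ContinuousOn h1 (K ∩ {z | z.re ≤ c}) ∧
    ContinuousOn h2 (K ∩ {z | c ≤ z.re}) ∧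
    (∀ z ∈ K ∩ {z | z.re ≤ c}, Complex.exp (h1 z) = f z) ∧
    (∀ z ∈ K ∩ {z | c ≤ z.re}, Complex.exp (h2 z) = f z) ∧
    (∀ z ∈ K, z.re = c → z.im ≤ t → h1 z - h2 z = 0) ∧
    (∀ z ∈ K, z.re = c → t ≤ z.im → h1 z - h2 z = n0 z + j * (2 * Real.pi * I))) :
    ∃ h1 h2 : ℂ → ℂ, ContinuousOn h1 (K ∩ {z | z.re ≤ c}) ∧
    ContinuousOn h2 (K ∩ {z | c ≤ z.re}) ∧
    (∀ z ∈ K ∩ {z | z.re ≤ c}, Complex.exp (h1 z) = f z) ∧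
    (∀ z ∈ K ∩ {z | c ≤ z.re}, Complex.exp (h2 z) = f z) ∧
    (∀ z ∈ K, z.re = c → z.im ≤ t → h1 z - h2 z = 0) ∧
    (∀ z ∈ K, z.re = c → t ≤ z.im → h1 z - h2 z = n0 z + m * (2 * Real.pi * I)) := by
  obtain ⟨c1, c2, e1, e2, d1, d2⟩ := hh
  obtain ⟨l, hl, hl'⟩ := hK.2 _ ht
  set a : ℂ := ⟨c, t⟩ with ha
  have hne : ∀ z ∈ K, z - a ≠ 0 := fun z hz h => ht (by rw [← sub_eq_zero.mp h]; exact hz)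
  have him : ∀ z ∈ K, z.re = c → z.im ≠ t := fun z hz h h' => hne z hz (by
    rw [sub_eq_zero]; exact Complex.ext h h')
  have s1 : ∀ z ∈ K ∩ {z | z.re ≤ c}, -(z - a) ∈ slitPlane := by
    rintro z ⟨hz, hz'⟩
    rw [mem_slitPlane_iff]
    rcases lt_or_eq_of_le (show z.re ≤ c from hz') with h | h
    · left; simp [ha, h]
    · right
      simp only [neg_im, sub_im, ha]
      intro h'; exact him z hz h (by linarith)
  have s2 : ∀ z ∈ K ∩ {z | c ≤ z.re}, (z - a) ∈ slitPlane := by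
    rintro z ⟨hz, hz'⟩
    rw [mem_slitPlane_iff]
    rcases lt_or_eq_of_le (show c ≤ z.re from hz') with h | h
    · left; simp [ha, h]
    · right
      simp only [sub_im, ha]
      intro h'; exact him z hz h.symm (by linarith)
  refine ⟨fun z => h1 z + (j - m : ℤ) * (Complex.log (-(z - a)) + Real.pi * I - l z
      - 2 * Real.pi * I),
    fun z => h2 z + (j - m : ℤ) * (Complex.log (z - a) - l z), ?_, ?_, ?_, ?_, ?_, ?_⟩
  · refine c1.add (continuousOn_const.mul (((ContinuousOn.add (ContinuousOn.clog (by fun_prop) s1)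
      continuousOn_const).sub (hl.mono Set.inter_subset_left)).sub continuousOn_const))
  · exact c2.add (continuousOn_const.mul ((ContinuousOn.clog (by fun_prop) s2).sub
      (hl.mono Set.inter_subset_left)))
  · intro z hz
    have : Complex.exp (Complex.log (-(z - a)) + Real.pi * I - l z - 2 * Real.pi * I) = 1 := by
      rw [Complex.exp_sub, Complex.exp_two_pi_mul_I, Complex.exp_sub, Complex.exp_add,
        Complex.exp_log (slitPlane_ne_zero (s1 z hz)), hl' z hz.1, Complex.exp_pi_mul_I]
      have := hne z hz.1
      field_simp
    rw [Complex.exp_add, Complex.exp_int_mul, this, e1 z hz]; simp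
  · intro z hz
    have : Complex.exp (Complex.log (z - a) - l z) = 1 := by
      rw [Complex.exp_sub, Complex.exp_log (slitPlane_ne_zero (s2 z hz)), hl' z hz.1]
      have := hne z hz.1
      field_simp
    rw [Complex.exp_add, Complex.exp_int_mul, this, e2 z hz]; simp
  · intro z hz hc him'
    have := logR_jump' (w := z - a) (by simp [hc, ha])
      (by simpa [ha] using lt_of_le_of_ne him' (him z hz hc))
    have h3 := d1 z hz hc him'
    linear_combination h3 + (j - m : ℤ) * this
  · intro z hz hc him'
    have := logR_jump (w := z - a) (by simp [hc, ha])
      (by simpa [ha] using lt_of_le_of_ne him' (him z hz hc).symm)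
    have h3 := d2 z hz hc him'
    push_cast
    linear_combination h3 + (j - m : ℂ) * this

lemma glue_re {K : Set ℂ} (hK : GoodSet K) {f : ℂ → ℂ} (c : ℝ)
    (h1 : HasLogOn (K ∩ {z | z.re ≤ c}) f) (h2 : HasLogOn (K ∩ {z | c ≤ z.re}) f) :
    HasLogOn K f := by
  obtain ⟨g1, c1, e1⟩ := h1
  obtain ⟨g2, c2, e2⟩ := h2
  have cl1 : IsClosed {z : ℂ | z.re ≤ c} := isClosed_le continuous_re continuous_const
  have cl2 : IsClosed {z : ℂ | c ≤ z.re} := isClosed_le continuous_const continuous_re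
  have hKc := hK.1.isClosed
  obtain ⟨R, hR⟩ := hK.1.isBounded.exists_norm_le
  set n0 : ℂ → ℂ := fun z => g1 z - g2 z with hn0
  have hpi : ‖(2 * Real.pi * I : ℂ)‖ = 2 * Real.pi := by
    simp [abs_of_pos Real.pi_pos]
  have local_const : ∀ z ∈ K, z.re = c → ∃ ε > 0, ∀ w ∈ K, w.re = c → |w.im - z.im| < ε →
      n0 w = n0 z := by
    intro z hz hzc
    have hc : ContinuousOn n0 (K ∩ {z | z.re = c}) := by
      refine (c1.mono ?_).sub (c2.mono ?_)
      · rintro w ⟨hw, hw'⟩; exact ⟨hw, le_of_eq hw'⟩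
      · rintro w ⟨hw, hw'⟩; exact ⟨hw, le_of_eq hw'.symm⟩
    obtain ⟨ε, hε, h⟩ := Metric.continuousOn_iff.mp hc z ⟨hz, hzc⟩ 1 one_pos
    refine ⟨ε, hε, fun w hw hwc hwz => ?_⟩
    have h3 := h w ⟨hw, hwc⟩ (by
      rw [dist_eq_norm]
      have : w - z = ((w.im - z.im : ℝ) : ℂ) * I := by
        apply Complex.ext <;> simp [hwc, hzc]
      rw [this, norm_mul, norm_I, mul_one, Complex.norm_real, Real.norm_eq_abs]
      exact hwz)
    have key : ∀ x ∈ K, x.re = c → ∃ n : ℤ, n0 x = n * (2 * Real.pi * I) := fun x hx hxc =>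
      exp_eq_exp_diff (by rw [e1 x ⟨hx, le_of_eq hxc⟩, e2 x ⟨hx, le_of_eq hxc.symm⟩])
    obtain ⟨n, hn⟩ := key w hw hwc
    obtain ⟨m, hm⟩ := key z hz hzc
    rw [hn, hm, dist_eq_norm, ← sub_mul, norm_mul, hpi] at h3
    have h4 : ‖((n - m : ℤ) : ℂ)‖ < 1 := by
      push_cast
      have := Real.pi_gt_three
      nlinarith [norm_nonneg ((n : ℂ) - m)]
    rw [Complex.norm_intCast] at h4
    have h5 : |n - m| < 1 := by exact_mod_cast h4
    have : n = m := by rw [Int.abs_lt_one_iff] at h5; omega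
    rw [hn, hm, this]
  have loc : ∀ t : ℝ, ∃ ε > 0, ∀ s s' : ℝ, |s - t| < ε → |s' - t| < ε →
      PairProp K f c n0 s → PairProp K f c n0 s' := by
    intro t
    by_cases ht : (⟨c, t⟩ : ℂ) ∈ K
    · obtain ⟨ε, hε, hloc⟩ := local_const _ ht rfl
      obtain ⟨k, hk⟩ : ∃ k : ℤ, n0 ⟨c, t⟩ = k * (2 * Real.pi * I) :=
        exp_eq_exp_diff (by
          rw [e1 _ ⟨ht, le_refl c⟩, e2 _ ⟨ht, le_refl c⟩])
      simp only [hk] at hloc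
      refine ⟨ε, hε, fun s s' hs hs' hP => ?_⟩
      have : ∃ h1 h2 : ℂ → ℂ, ContinuousOn h1 (K ∩ {z | z.re ≤ c}) ∧
        ContinuousOn h2 (K ∩ {z | c ≤ z.re}) ∧
        (∀ z ∈ K ∩ {z | z.re ≤ c}, Complex.exp (h1 z) = f z) ∧
        (∀ z ∈ K ∩ {z | c ≤ z.re}, Complex.exp (h2 z) = f z) ∧
        (∀ z ∈ K, z.re = c → z.im ≤ s → h1 z - h2 z = 0) ∧
        (∀ z ∈ K, z.re = c → s ≤ z.im →
          h1 z - h2 z = n0 z + (-k : ℤ) * (2 * Real.pi * I)) := by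
        obtain ⟨h1, h2, j, hh⟩ := hP
        by_cases hsK : (⟨c, s⟩ : ℂ) ∈ K
        · refine ⟨h1, h2, hh.1, hh.2.1, hh.2.2.1, hh.2.2.2.1, hh.2.2.2.2.1, ?_⟩
          intro z hz hzc hzs
          rw [hh.2.2.2.2.2 z hz hzc hzs]
          have a1 := hh.2.2.2.2.1 _ hsK rfl le_rfl
          have a2 := hh.2.2.2.2.2 _ hsK rfl le_rfl
          have a3 := hloc _ hsK rfl hs
          push_cast
          linear_combination a1 - a2 - a3
        · exact PairProp.adjust hK hsK (-k) hh
      obtain ⟨h1, h2, b1, b2, b3, b4, b5, b6⟩ := this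
      refine ⟨h1, h2, -k, b1, b2, b3, b4, ?_, ?_⟩
      · intro z hz hzc hzs
        rcases le_or_gt z.im s with h | h
        · exact b5 z hz hzc h
        · rw [b6 z hz hzc h.le, hloc z hz hzc]
          · push_cast; ring
          · rw [abs_lt] at *; constructor <;> linarith [hs.1, hs'.2]
      · intro z hz hzc hzs
        rcases le_or_gt s z.im with h | h
        · exact b6 z hz hzc h
        · rw [b5 z hz hzc h.le, hloc z hz hzc]
          · push_cast; ring
          · rw [abs_lt] at *; constructor <;> linarith [hs'.1, hs.2]
    · obtain ⟨ε, hε, hloc⟩ := Metric.isOpen_iff.mp hKc.isOpen_compl _ ht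
      have hno : ∀ z ∈ K, z.re = c → ¬ (|z.im - t| < ε) := by
        intro z hz hzc h
        refine hloc (a := z) ?_ hz
        rw [mem_ball, dist_eq_norm]
        have : z - ⟨c, t⟩ = ((z.im - t : ℝ) : ℂ) * I := by
          apply Complex.ext <;> simp [hzc]
        rw [this, norm_mul, norm_I, mul_one, Complex.norm_real, Real.norm_eq_abs]
        exact h
      refine ⟨ε, hε, fun s s' hs hs' hP => ?_⟩
      obtain ⟨h1, h2, j, b1, b2, b3, b4, b5, b6⟩ := hP
      rw [abs_lt] at hs hs'
      refine ⟨h1, h2, j, b1, b2, b3, b4, fun z hz hzc h => b5 z hz hzc ?_,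
        fun z hz hzc h => b6 z hz hzc ?_⟩
      · by_contra hcon
        exact hno z hz hzc (by rw [abs_lt]; constructor <;> linarith)
      · by_contra hcon
        exact hno z hz hzc (by rw [abs_lt]; constructor <;> linarith)
  have start : PairProp K f c n0 (-R - 1) := by
    refine ⟨g1, g2, 0, c1, c2, e1, e2, fun z hz _ h => ?_, fun z hz _ h => ?_⟩
    · have := hR z hz
      have := abs_le.mp ((Complex.abs_im_le_norm z).trans this)
      linarith
    · simp [hn0]
  have fin : PairProp K f c n0 (R + 1) := by
    refine PreconnectedSpace.induction₂' (fun s t => PairProp K f c n0 s → PairProp K f c n0 t)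
      (fun t => ?_) ⟨fun a b c h h' x => h' (h x)⟩ (-R - 1) (R + 1) start
    obtain ⟨ε, hε, h⟩ := loc t
    filter_upwards [Metric.ball_mem_nhds t hε] with s hs
    rw [mem_ball, Real.dist_eq] at hs
    exact ⟨h t s (by simpa) hs, h s t hs (by simpa)⟩
  obtain ⟨h1, h2, j, b1, b2, b3, b4, b5, -⟩ := fin
  have agree : ∀ z ∈ K, z.re = c → h1 z = h2 z := fun z hz hzc => by
    have := hR z hz
    have := abs_le.mp ((Complex.abs_im_le_norm z).trans this)
    exact sub_eq_zero.mp (b5 z hz hzc (by linarith))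
  classical
  have q1 : ∀ z ∈ K ∩ {z | z.re ≤ c}, (if z.re ≤ c then h1 z else h2 z) = h1 z :=
    fun z hz => if_pos hz.2
  have q2 : ∀ z ∈ K ∩ {z | c ≤ z.re}, (if z.re ≤ c then h1 z else h2 z) = h2 z := by
    intro z hz
    split_ifs with h
    · exact agree z hz.1 (le_antisymm h hz.2)
    · rfl
  have hcov : K = (K ∩ {z | z.re ≤ c}) ∪ (K ∩ {z | c ≤ z.re}) := by
    ext z; simp only [Set.mem_union, Set.mem_inter_iff, Set.mem_ofPred_eq]
    have := le_total z.re c; tauto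
  refine ⟨fun z => if z.re ≤ c then h1 z else h2 z, ?_, ?_⟩
  · rw [hcov]
    exact (b1.congr q1).union_of_isClosed (b2.congr q2) (hKc.inter cl1) (hKc.inter cl2)
  · intro z hz
    rcases le_total z.re c with h | h
    · simp only [q1 z ⟨hz, h⟩, b3 z ⟨hz, h⟩]
    · simp only [q2 z ⟨hz, h⟩, b4 z ⟨hz, h⟩]

lemma glue_im {K : Set ℂ} (hK : GoodSet K) {f : ℂ → ℂ} (c : ℝ)
    (h1 : HasLogOn (K ∩ {z | z.im ≤ c}) f) (h2 : HasLogOn (K ∩ {z | c ≤ z.im}) f) :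
    HasLogOn K f := by
  have cφ : Continuous (fun w : ℂ => I * w) := by fun_prop
  have cψ : Continuous (fun w : ℂ => -I * w) := by fun_prop
  have id1 : ∀ z : ℂ, I * (-I * z) = z := fun z => by
    linear_combination (-z) * I_mul_I
  have id2 : ∀ z : ℂ, -I * (I * z) = z := fun z => by
    linear_combination (-z) * I_mul_I
  have hK' : GoodSet ((fun w : ℂ => I * w) ⁻¹' K) := by
    constructor
    · have : (fun w : ℂ => I * w) ⁻¹' K = (fun w : ℂ => -I * w) '' K := by
        ext z; constructor
        · intro h; exact ⟨I * z, h, id2 z⟩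
        · rintro ⟨w, hw, rfl⟩
          change I * (-I * w) ∈ K
          rwa [id1]
      rw [this]
      exact hK.1.image cψ
    · intro a ha
      have := (hK.2 (I * a) ha).comp cφ
      refine this.mul (hasLogOn_const _ (c := -I) (by simp)) fun z hz => ?_
      linear_combination (z - a) * I_mul_I
  have := glue_re hK' (f := fun w => f (I * w)) c ?_ ?_
  · have h3 := this.comp cψ
    obtain ⟨g, hg, hg'⟩ := h3
    have hsub : K ⊆ (fun w : ℂ => -I * w) ⁻¹' ((fun w : ℂ => I * w) ⁻¹' K) := by
      intro z hz
      change I * (-I * z) ∈ K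
      rwa [id1]
    refine ⟨g, hg.mono hsub, fun z hz => ?_⟩
    rw [hg' z (hsub hz)]
    simp only [id1]
  · refine (h1.comp cφ).mono ?_
    rintro z ⟨hz, hz'⟩
    exact ⟨hz, by simpa using hz'⟩
  · refine (h2.comp cφ).mono ?_
    rintro z ⟨hz, hz'⟩
    exact ⟨hz, by simpa using hz'⟩

lemma GoodSet.inter_half {K : Set ℂ} (hK : GoodSet K) {u : ℂ} (hu : u ≠ 0) (c : ℝ) :
    GoodSet (K ∩ {z | (u * z).re ≤ c}) := by
  refine ⟨hK.1.inter_right (isClosed_le (by fun_prop) continuous_const), fun a ha => ?_⟩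
  by_cases haK : a ∈ K
  · have hac : c < (u * a).re := by
      by_contra h
      exact ha ⟨haK, not_lt.mp h⟩
    refine (hasLogOn_const _ (c := -1 / u) (by simp [hu])).mul (g := fun z => u * (a - z))
      (hasLogOn_slit (by fun_prop) fun z hz => ?_) fun z hz => by field_simp; ring
    left
    have : (u * z).re ≤ c := hz.2
    rw [mul_sub, sub_re]
    linarith
  · exact (hK.2 a haK).mono Set.inter_subset_left

lemma GoodSet.inter_re_le {K : Set ℂ} (hK : GoodSet K) (c : ℝ) :
    GoodSet (K ∩ {z | z.re ≤ c}) := by simpa using hK.inter_half (one_ne_zero) c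

lemma GoodSet.inter_le_re {K : Set ℂ} (hK : GoodSet K) (c : ℝ) :
    GoodSet (K ∩ {z | c ≤ z.re}) := by
  simpa using hK.inter_half (neg_ne_zero.mpr one_ne_zero) (-c)

lemma GoodSet.inter_im_le {K : Set ℂ} (hK : GoodSet K) (c : ℝ) :
    GoodSet (K ∩ {z | z.im ≤ c}) := by simpa using hK.inter_half (u := -I) (by simp) c

lemma GoodSet.inter_le_im {K : Set ℂ} (hK : GoodSet K) (c : ℝ) :
    GoodSet (K ∩ {z | c ≤ z.im}) := by simpa using hK.inter_half (u := I) (by simp) (-c)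

lemma GoodSet.hasLogOn {K : Set ℂ} (hK : GoodSet K) {f : ℂ → ℂ} (hf : ContinuousOn f K)
    (h0 : ∀ z ∈ K, f z ≠ 0) : HasLogOn K f := by
  rcases K.eq_empty_or_nonempty with rfl | hne
  · exact ⟨f, hf, by simp⟩
  obtain ⟨z0, hz0, hmin⟩ := hK.1.exists_isMinOn hne hf.norm
  have huc := hK.1.uniformContinuousOn_of_continuous hf
  obtain ⟨δ, hδ, huc⟩ := Metric.uniformContinuousOn_iff.mp huc ‖f z0‖ (norm_pos_iff.mpr (h0 z0 hz0))
  have small : ∀ L ⊆ K, (∀ z ∈ L, ∀ w ∈ L, dist z w < δ) → HasLogOn L f := by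
    intro L hL hd
    rcases L.eq_empty_or_nonempty with rfl | ⟨w, hw⟩
    · exact ⟨f, hf.mono hL, by simp⟩
    · refine hasLogOn_of_near (hf.mono hL) (c := f w) fun z hz => ?_
      rw [← dist_eq_norm]
      exact (huc z (hL hz) w (hL hw) (hd z hz w hw)).trans_le (hmin (hL hw))
  obtain ⟨η, hη, hηδ⟩ : ∃ η > 0, η + η < δ := ⟨δ / 3, by positivity, by linarith⟩
  have cell : ∀ L ⊆ K, ∀ a b : ℝ, (∀ z ∈ L, a ≤ z.re ∧ z.re ≤ a + η ∧ b ≤ z.im ∧ z.im ≤ b + η) →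
      HasLogOn L f := by
    intro L hL a b h
    refine small L hL fun z hz w hw => ?_
    obtain ⟨a1, a2, a3, a4⟩ := h z hz
    obtain ⟨b1, b2, b3, b4⟩ := h w hw
    rw [dist_eq_norm]
    refine (Complex.norm_le_abs_re_add_abs_im _).trans_lt ?_
    have h1 : |(z - w).re| ≤ η := by rw [abs_le, sub_re]; constructor <;> linarith
    have h2 : |(z - w).im| ≤ η := by rw [abs_le, sub_im]; constructor <;> linarith
    linarith
  have strip : ∀ n : ℕ, ∀ L ⊆ K, GoodSet L → ∀ a b : ℝ,
      (∀ z ∈ L, a ≤ z.re ∧ z.re ≤ a + n * η ∧ b ≤ z.im ∧ z.im ≤ b + η) → HasLogOn L f := by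
    intro n
    induction n with
    | zero =>
      intro L hL _ a b h
      refine cell L hL a b fun z hz => ?_
      have := h z hz
      simp only [Nat.cast_zero, zero_mul] at this
      refine ⟨this.1, by linarith [this.2.1], this.2.2⟩
    | succ n ih =>
      intro L hL hg a b h
      refine glue_re hg (a + n * η) ?_ ?_
      · refine ih _ (Set.inter_subset_left.trans hL) (hg.inter_re_le _) a b fun z hz => ?_
        have := h z hz.1
        exact ⟨this.1, hz.2, this.2.2⟩
      · refine cell _ (Set.inter_subset_left.trans hL) (a + n * η) b fun z hz => ?_
        have := h z hz.1
        push_cast at this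
        exact ⟨hz.2, by linarith [this.2.1], this.2.2⟩
  have rect : ∀ m n : ℕ, ∀ L ⊆ K, GoodSet L → ∀ a b : ℝ,
      (∀ z ∈ L, a ≤ z.re ∧ z.re ≤ a + n * η ∧ b ≤ z.im ∧ z.im ≤ b + m * η) → HasLogOn L f := by
    intro m n
    induction m with
    | zero =>
      intro L hL hg a b h
      refine strip n L hL hg a b fun z hz => ?_
      have := h z hz
      simp only [Nat.cast_zero, zero_mul] at this
      refine ⟨this.1, this.2.1, this.2.2.1, by linarith [this.2.2.2]⟩
    | succ m ih =>
      intro L hL hg a b h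
      refine glue_im hg (b + m * η) ?_ ?_
      · refine ih _ (Set.inter_subset_left.trans hL) (hg.inter_im_le _) a b fun z hz => ?_
        have := h z hz.1
        exact ⟨this.1, this.2.1, this.2.2.1, hz.2⟩
      · refine strip n _ (Set.inter_subset_left.trans hL) (hg.inter_le_im _) a (b + m * η)
          fun z hz => ?_
        have := h z hz.1
        push_cast at this
        exact ⟨this.1, this.2.1, hz.2, by linarith [this.2.2.2]⟩
  obtain ⟨R, hR⟩ := hK.1.isBounded.exists_norm_le
  obtain ⟨n, hn⟩ := exists_nat_ge (2 * R / η)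
  rw [div_le_iff₀ hη] at hn
  refine rect n n K subset_rfl hK (-R) (-R) fun z hz => ?_
  have h1 := abs_le.mp ((Complex.abs_re_le_norm z).trans (hR z hz))
  have h2 := abs_le.mp ((Complex.abs_im_le_norm z).trans (hR z hz))
  exact ⟨h1.1, by linarith, h2.1, by linarith⟩

lemma hasLogOn_sub_of_large {K : Set ℂ} {R : ℝ} (hR : ∀ z ∈ K, ‖z‖ ≤ R) {a : ℂ} (ha : R < ‖a‖) :
    HasLogOn K (fun z => z - a) := by
  refine hasLogOn_of_near (by fun_prop) (c := -a) fun z hz => ?_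
  simpa using (hR z hz).trans_lt ha

lemma hasLogOn_sub_of_preconnected {K : Set ℂ} (hK : IsClosed K) {R : ℝ} (hR : ∀ z ∈ K, ‖z‖ ≤ R)
    {U : Set ℂ} (hU : IsPreconnected U) (hUK : ∀ z ∈ U, z ∉ K) (hub : ¬ IsBounded U) {a : ℂ}
    (ha : a ∈ U) : HasLogOn K (fun z => z - a) := by
  obtain ⟨b, hbU, hb⟩ : ∃ b ∈ U, R < ‖b‖ := by
    by_contra! h
    exact hub (isBounded_iff_forall_norm_le.mpr ⟨R, h⟩)
  have aux : ∀ x ∉ K, ∃ ε > 0, ∀ y, dist y x < ε →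
      HasLogOn K (fun z => (z - y) / (z - x)) ∧ HasLogOn K (fun z => (z - x) / (z - y)) := by
    intro x hx
    obtain ⟨ε, hε, hb⟩ := Metric.isOpen_iff.mp hK.isOpen_compl x hx
    have hfar : ∀ z ∈ K, ε ≤ dist z x := fun z hz => by
      by_contra h
      exact hb (mem_ball.mpr (not_le.mp h)) hz
    refine ⟨ε, hε, fun y hy => ?_⟩
    have hx0 : ∀ z ∈ K, z - x ≠ 0 := fun z hz h => by
      rw [sub_eq_zero] at h; subst h; exact hx hz
    have hnear : HasLogOn K (fun z => (z - y) / (z - x)) := by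
      refine hasLogOn_of_near (c := 1) (ContinuousOn.div (by fun_prop) (by fun_prop) hx0)
        fun z hz => ?_
      have e : (z - y) / (z - x) - 1 = (x - y) / (z - x) := by
        have := hx0 z hz
        field_simp; ring
      rw [e, norm_div, norm_one, div_lt_one (norm_pos_iff.mpr (hx0 z hz)), ← dist_eq_norm,
        ← dist_eq_norm, dist_comm]
      exact hy.trans_le (hfar z hz)
    refine ⟨hnear, ?_⟩
    obtain ⟨g, hg, hg'⟩ := hnear
    exact ⟨fun z => - g z, hg.neg, fun z hz => by rw [Complex.exp_neg, hg' z hz, inv_div]⟩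
  have step : ∀ x ∉ K, ∀ y, HasLogOn K (fun z => (z - y) / (z - x)) →
      HasLogOn K (fun z => z - x) → HasLogOn K (fun z => z - y) := by
    intro x hx y h1 h2
    refine h1.mul h2 fun z hz => ?_
    have : z - x ≠ 0 := fun h => by
      rw [sub_eq_zero] at h; subst h; exact hx hz
    field_simp
  refine hU.induction₂' (fun x y => HasLogOn K (fun z => z - x) → HasLogOn K (fun z => z - y))
    (fun x hx => ?_) (fun x y z _ _ _ h h' q => h' (h q)) hbU ha (hasLogOn_sub_of_large hR hb)
  obtain ⟨ε, hε, h⟩ := aux x (hUK x hx)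
  filter_upwards [self_mem_nhdsWithin, nhdsWithin_le_nhds (Metric.ball_mem_nhds x hε)] with y hy hyx
  exact ⟨step x (hUK x hx) y (h y hyx).1, step y (hUK y hy) x (h y hyx).2⟩

/-- all complementary components unbounded (in a convenient form) -/
def NoHoles (E : Set ℂ) : Prop :=
  ∀ a ∉ E, ∃ U : Set ℂ, IsPreconnected U ∧ a ∈ U ∧ (∀ z ∈ U, z ∉ E) ∧ ¬ IsBounded U

lemma extend_step {E : Set ℂ} (hE : IsClosed E) (hN : NoHoles E) {f : ℂ → ℂ}
    (hf : ContinuousOn f E) (h0 : ∀ z ∈ E, f z ≠ 0) (R : ℝ) :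
    ∃ f' : ℂ → ℂ, ContinuousOn f' (E ∪ closedBall 0 R) ∧
      (∀ z ∈ E ∪ closedBall 0 R, f' z ≠ 0) ∧ ∀ z ∈ E, f' z = f z := by
  have hcl : IsClosed (E ∩ closedBall 0 R) := hE.inter isClosed_closedBall
  have hgood : GoodSet (E ∩ closedBall 0 R) := by
    refine ⟨(isCompact_closedBall 0 R).inter_left hE, fun a ha => ?_⟩
    by_cases haE : a ∈ E
    · refine hasLogOn_sub_of_large (R := R) (fun z hz => by simpa using hz.2) ?_
      by_contra h
      exact ha ⟨haE, by simpa using h⟩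
    · obtain ⟨U, hU, haU, hUE, hub⟩ := hN a haE
      exact hasLogOn_sub_of_preconnected hcl (R := R) (fun z hz => by simpa using hz.2) hU
        (fun z hz h => hUE z hz h.1) hub haU
  obtain ⟨g, hg, hg'⟩ := hgood.hasLogOn (hf.mono Set.inter_subset_left) (fun z hz => h0 z hz.1)
  obtain ⟨G, hG⟩ := ContinuousMap.exists_restrict_eq hcl ⟨_, hg.domRestrict⟩
  have hG' : ∀ z ∈ E ∩ closedBall 0 R, G z = g z := fun z hz => by
    have := DFunLike.congr_fun hG ⟨z, hz⟩
    simpa using this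
  classical
  have q1 : ∀ z ∈ E, (if z ∈ E then f z else Complex.exp (G z)) = f z := fun z hz => if_pos hz
  have q2 : ∀ z ∈ closedBall (0 : ℂ) R, (if z ∈ E then f z else Complex.exp (G z))
      = Complex.exp (G z) := by
    intro z hz
    split_ifs with h
    · rw [hG' z ⟨h, hz⟩, hg' z ⟨h, hz⟩]
    · rfl
  refine ⟨fun z => if z ∈ E then f z else Complex.exp (G z), ?_, ?_, q1⟩
  · refine (hf.congr q1).union_of_isClosed (ContinuousOn.congr ?_ q2) hE isClosed_closedBall
    exact (Complex.continuous_exp.comp G.continuous).continuousOn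
  · rintro z (hz | hz)
    · simp only [q1 z hz]; exact h0 z hz
    · simp only [q2 z hz]; exact Complex.exp_ne_zero _

/-- hull of `F ∪ K` -/
def hullSet (F K : Set ℂ) : Set ℂ :=
  {z | ¬ (z ∈ (F ∪ K)ᶜ ∧ ¬ IsBounded (connectedComponentIn (F ∪ K)ᶜ z))}

lemma subset_hullSet (F K : Set ℂ) : F ∪ K ⊆ hullSet F K := fun _ hz h => h.1 hz

lemma hullSet_noHoles (F K : Set ℂ) : NoHoles (hullSet F K) := by
  intro a ha
  have ha' : a ∈ (F ∪ K)ᶜ ∧ ¬ IsBounded (connectedComponentIn (F ∪ K)ᶜ a) := not_not.mp ha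
  refine ⟨_, isPreconnected_connectedComponentIn, mem_connectedComponentIn ha'.1, ?_, ha'.2⟩
  intro z hz h
  refine h ⟨connectedComponentIn_subset _ _ hz, ?_⟩
  rw [← connectedComponentIn_eq hz]
  exact ha'.2

lemma hullSet_isClosed {F K : Set ℂ} (hF : IsClosed F) (hK : IsClosed K) :
    IsClosed (hullSet F K) := by
  rw [← isOpen_compl_iff, isOpen_iff_mem_nhds]
  intro a ha
  have ha' : a ∈ (F ∪ K)ᶜ ∧ ¬ IsBounded (connectedComponentIn (F ∪ K)ᶜ a) := not_not.mp ha
  have ho : IsOpen (connectedComponentIn (F ∪ K)ᶜ a) :=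
    (hF.union hK).isOpen_compl.connectedComponentIn
  filter_upwards [ho.mem_nhds (mem_connectedComponentIn ha'.1)] with z hz h
  refine h ⟨connectedComponentIn_subset _ _ hz, ?_⟩
  rw [← connectedComponentIn_eq hz]
  exact ha'.2

lemma hullSet_mono (F : Set ℂ) {K L : Set ℂ} (h : K ⊆ L) : hullSet F K ⊆ hullSet F L := by
  intro z hz hz'
  have hsub : (F ∪ L)ᶜ ⊆ (F ∪ K)ᶜ := Set.compl_subset_compl.mpr (Set.union_subset_union_right F h)
  exact hz ⟨hsub hz'.1, fun hb => hz'.2 (hb.subset (connectedComponentIn_mono z hsub))⟩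

lemma hullSet_empty {F : Set ℂ} (hA : IsArakelian F) : hullSet F ∅ = F := by
  ext z
  simp only [hullSet, Set.union_empty]
  constructor
  · intro h
    by_contra hz
    exact h ⟨hz, hA.1 z hz⟩
  · intro h h'
    exact h'.1 h

lemma hullSet_bounded {F : Set ℂ} (hA : IsArakelian F) (r : ℝ) :
    ∃ R, hullSet F (closedBall 0 r) ⊆ F ∪ closedBall 0 R := by
  obtain ⟨R, hR⟩ := (hA.2 _ (isCompact_closedBall 0 r)).exists_norm_le
  refine ⟨max r R, fun z hz => ?_⟩
  by_cases h : z ∈ F ∪ closedBall 0 r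
  · exact h.imp id (fun h => closedBall_subset_closedBall (le_max_left _ _) h)
  · right
    have : IsBounded (connectedComponentIn (F ∪ closedBall 0 r)ᶜ z) := by
      by_contra hb
      exact hz ⟨h, hb⟩
    simpa using Or.inr (hR z ⟨h, this⟩)

theorem arakelian_exists_log (F : Set ℂ) (hF : IsClosed F) (hA : IsArakelian F) :
    ∀ f : ℂ → ℂ, ContinuousOn f F → DifferentiableOn ℂ f (interior F) →
      (∀ z ∈ F, f z ≠ 0) →
      ∃ g : ℂ → ℂ, ContinuousOn g F ∧ DifferentiableOn ℂ g (interior F) ∧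
        ∀ z ∈ F, Complex.exp (g z) = f z := by
  intro f hf hd h0
  set E : ℕ → Set ℂ := fun n => hullSet F (closedBall 0 ((n : ℝ) - 1)) with hE
  have E0 : E 0 = F := by
    simp only [hE]
    rw [closedBall_eq_empty.mpr (by simp), hullSet_empty hA]
  have Emono : ∀ n, E n ⊆ E (n + 1) := fun n =>
    hullSet_mono F (closedBall_subset_closedBall (by push_cast; linarith))
  have EF : ∀ n, F ⊆ E n := fun n => Set.subset_union_left.trans (subset_hullSet _ _)
  have Eball : ∀ n : ℕ, closedBall 0 ((n : ℝ) - 1) ⊆ E n :=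
    fun n => Set.subset_union_right.trans (subset_hullSet _ _)
  have step : ∀ n, ∀ u : ℂ → ℂ, ∃ v : ℂ → ℂ, ContinuousOn u (E n) ∧ (∀ z ∈ E n, u z ≠ 0) →
      (ContinuousOn v (E (n + 1)) ∧ (∀ z ∈ E (n + 1), v z ≠ 0)) ∧ ∀ z ∈ E n, v z = u z := by
    intro n u
    by_cases hu : ContinuousOn u (E n) ∧ (∀ z ∈ E n, u z ≠ 0)
    · obtain ⟨R, hR⟩ := hullSet_bounded hA (((n + 1 : ℕ) : ℝ) - 1)
      have hsub : E (n + 1) ⊆ E n ∪ closedBall 0 R :=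
        hR.trans (Set.union_subset_union_left _ (EF n))
      obtain ⟨v, v1, v2, v3⟩ := extend_step (hullSet_isClosed hF isClosed_closedBall)
        (hullSet_noHoles _ _) hu.1 hu.2 R
      exact ⟨v, fun _ => ⟨⟨v1.mono hsub, fun z hz => v2 z (hsub hz)⟩, v3⟩⟩
    · exact ⟨u, fun h => absurd h hu⟩
  choose nxt hnxt using step
  let s : ℕ → ℂ → ℂ := fun n => Nat.rec f (fun n u => nxt n u) n
  have s0 : s 0 = f := rfl
  have hs : ∀ n, s (n + 1) = nxt n (s n) := fun n => rfl
  have good : ∀ n, ContinuousOn (s n) (E n) ∧ (∀ z ∈ E n, s n z ≠ 0) := by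
    intro n
    induction n with
    | zero => rw [E0, s0]; exact ⟨hf, h0⟩
    | succ n ih => rw [hs]; exact (hnxt n _ ih).1
  have agree1 : ∀ n, ∀ z ∈ E n, s (n + 1) z = s n z := fun n => by
    rw [hs]; exact (hnxt n _ (good n)).2
  have Emono' : Monotone E := monotone_nat_of_le_succ Emono
  have agree : ∀ n m, n ≤ m → ∀ z ∈ E n, s m z = s n z := by
    intro n m hnm z hz
    induction m, hnm using Nat.le_induction with
    | base => rfl
    | succ m hm ih => rw [agree1 m z (Emono' hm hz), ih]
  let N : ℂ → ℕ := fun z => ⌈‖z‖⌉₊ + 1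
  have hN : ∀ z, z ∈ E (N z) := fun z => Eball _ (by
    simp only [N, mem_closedBall, dist_zero_right]
    push_cast
    linarith [Nat.le_ceil ‖z‖])
  let T : ℂ → ℂ := fun z => s (N z) z
  have hT : ∀ n, ∀ z ∈ E n, T z = s n z := fun n z hz => by
    rcases le_total n (N z) with h | h
    · exact agree _ _ h z hz
    · exact (agree _ _ h z (hN z)).symm
  have Tc : Continuous T := by
    rw [continuous_iff_continuousAt]
    intro z
    have hnb : E (N z + 1) ∈ nhds z := by
      refine Filter.mem_of_superset (Metric.ball_mem_nhds z one_pos) fun w hw => Eball _ ?_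
      simp only [N, mem_closedBall, dist_zero_right]
      push_cast
      rw [mem_ball, dist_eq_norm] at hw
      have := norm_sub_norm_le w z
      linarith [Nat.le_ceil ‖z‖]
    exact ((good (N z + 1)).1.congr (hT _)).continuousAt hnb
  have T0 : ∀ z, T z ≠ 0 := fun z => (good _).2 z (hN z)
  have hTF : ∀ z ∈ F, T z = f z := fun z hz => hT 0 z (by rwa [E0])
  obtain ⟨G, ⟨-, hG⟩, -⟩ := isCoveringMapOn_exp.existsUnique_continuousMap_lifts
    (A := ℂ) ⟨T, Tc⟩ (a₀ := 0) (e₀ := Complex.log (T 0)) (Complex.exp_log (T0 0)) T0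
  have hG' : ∀ z, Complex.exp (G z) = T z := fun z => congrFun hG z
  refine ⟨G, G.continuous.continuousOn, ?_, fun z hz => by rw [hG', hTF z hz]⟩
  intro z hz
  have hnb : interior F ∈ nhds z := isOpen_interior.mem_nhds hz
  have hdf : DifferentiableAt ℂ T z := by
    refine (hd.differentiableAt hnb).congr_of_eventuallyEq ?_
    filter_upwards [hnb] with w hw
    exact hTF w (interior_subset hw)
  have hev : ∀ᶠ w in nhds z, Complex.log (T w / T z) + G z = G w := by
    have hc : ContinuousAt (fun w => G w - G z) z := by fun_prop
    have : ∀ᶠ w in nhds z, dist (G w - G z) (G z - G z) < 1 :=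
      hc.eventually (Metric.ball_mem_nhds _ one_pos)
    filter_upwards [this] with w hw
    rw [sub_self, dist_zero_right] at hw
    have him := abs_lt.mp ((Complex.abs_im_le_norm _).trans_lt hw)
    rw [← hG', ← hG', ← Complex.exp_sub, Complex.log_exp (by linarith [Real.pi_gt_three])
      (by linarith [Real.pi_gt_three])]
    ring
  have hlog : DifferentiableAt ℂ (fun w => Complex.log (T w / T z) + G z) z := by
    refine (DifferentiableAt.clog (hdf.div_const _) ?_).add_const _
    rw [div_self (T0 z)]
    exact one_mem_slitPlane
  exact (hlog.congr_of_eventuallyEq (hev.mono fun w hw => hw.symm)).differentiableWithinAt
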